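/- Let m, n be positive integers, let Ψ₁, ..., Ψₘ be nonempty bounded sets of n×n matrices with nonnegative real entries, and let α₁, ..., αₘ be positive real numbers with α₁ + ⋯ + αₘ = 1. Then ρ(Ψ₁^(α₁) ∘ ⋯ ∘ Ψₘ^(αₘ)) ≤ ρ(Ψ₁)^{α₁} ⋯ ρ(Ψₘ)^{αₘ}, where ρ denotes the generalized spectral radius of a set. -/

import Mathlib

open scoped ENNReal NNReal BigOperators

/-- Spectral radius of a real matrix: the spectral radius of the corresponding
complex matrix (equivalently, the maximum modulus of its complex eigenvalues). -/
noncomputable def specRad {n : ℕ} (A : Matrix (Fin n) (Fin n) ℝ) : ℝ≥0∞ :=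
  spectralRadius ℂ (A.map (fun x => (x : ℂ)))

/-- Operator norm of a real `n × n` matrix induced by the Euclidean norm on `ℝⁿ`. -/
noncomputable def opNorm {n : ℕ} (A : Matrix (Fin n) (Fin n) ℝ) : ℝ :=
  ‖LinearMap.toContinuousLinearMap (Matrix.toEuclideanLin A)‖

/-- The weighted Hadamard (Schur) geometric mean `A₁^(α₁) ∘ ⋯ ∘ Aₘ^(αₘ)`. -/
noncomputable def hadWMean {n m : ℕ} (α : Fin m → ℝ)
    (A : Fin m → Matrix (Fin n) (Fin n) ℝ) : Matrix (Fin n) (Fin n) ℝ :=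
  Matrix.of fun x y => ∏ j, (A j x y) ^ (α j)

/-- The ordered product `A 0 * A 1 * ⋯ * A (k-1)`. -/
def matListProd {n k : ℕ} (A : Fin k → Matrix (Fin n) (Fin n) ℝ) :
    Matrix (Fin n) (Fin n) ℝ :=
  (List.ofFn A).prod

/-- The set `Σ^k` of all products of `k` elements of `S`. -/
def setPow {n : ℕ} (S : Set (Matrix (Fin n) (Fin n) ℝ)) (k : ℕ) :
    Set (Matrix (Fin n) (Fin n) ℝ) :=
  {B | ∃ A : Fin k → Matrix (Fin n) (Fin n) ℝ, (∀ i, A i ∈ S) ∧ B = matListProd A}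

/-- The set `Ψ₁ Ψ₂ ⋯ Ψₘ` of products with the `j`-th factor from `Ψ j`. -/
def setProd {n m : ℕ} (Ψ : Fin m → Set (Matrix (Fin n) (Fin n) ℝ)) :
    Set (Matrix (Fin n) (Fin n) ℝ) :=
  {B | ∃ A : Fin m → Matrix (Fin n) (Fin n) ℝ, (∀ j, A j ∈ Ψ j) ∧ B = matListProd A}

/-- The weighted Hadamard geometric mean `Ψ₁^(α₁) ∘ ⋯ ∘ Ψₘ^(αₘ)` of sets. -/
noncomputable def setHadWMean {n m : ℕ} (α : Fin m → ℝ)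
    (Ψ : Fin m → Set (Matrix (Fin n) (Fin n) ℝ)) :
    Set (Matrix (Fin n) (Fin n) ℝ) :=
  {B | ∃ A : Fin m → Matrix (Fin n) (Fin n) ℝ, (∀ j, A j ∈ Ψ j) ∧ B = hadWMean α A}

/-- The generalized spectral radius `ρ(Σ) = limsup_{k→∞} (sup_{A ∈ Σ^k} ρ(A))^{1/k}`. -/
noncomputable def genSpecRad {n : ℕ} (S : Set (Matrix (Fin n) (Fin n) ℝ)) : ℝ≥0∞ :=
  Filter.atTop.limsup fun k : ℕ => (⨆ B ∈ setPow S k, specRad B) ^ (1 / (k : ℝ))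

/-- The joint spectral radius `ρ̂(Σ) = limsup_{k→∞} (sup_{A ∈ Σ^k} ‖A‖)^{1/k}`. -/
noncomputable def jointSpecRad {n : ℕ} (S : Set (Matrix (Fin n) (Fin n) ℝ)) : ℝ≥0∞ :=
  Filter.atTop.limsup fun k : ℕ =>
    (⨆ B ∈ setPow S k, ENNReal.ofReal (opNorm B)) ^ (1 / (k : ℝ))

section WeightedHadamardMeans

open Filter Topology Finset

attribute [local instance] Matrix.linftyOpNormedRing Matrix.linftyOpNormedAlgebra

/-- Hölder's inequality for finite sums of weighted geometric means in `ℝ≥0∞`. -/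
lemma ENNReal.sum_prod_rpow_le {ι κ : Type*} [Fintype ι] [Fintype κ] (f : ι → κ → ℝ≥0∞)
    {α : ι → ℝ} (hα : ∀ j, 0 ≤ α j) (hαsum : ∑ j, α j = 1) :
    ∑ z, ∏ j, f j z ^ α j ≤ ∏ j, (∑ z, f j z) ^ α j := by
  let _ : MeasurableSpace κ := ⊤
  simpa [MeasureTheory.lintegral_fintype, MeasureTheory.Measure.count_singleton] using
    ENNReal.lintegral_prod_norm_pow_le (μ := MeasureTheory.Measure.count) univ
      (f := f) (fun _ _ => (measurable_of_finite _).aemeasurable) hαsum (fun j _ => hα j)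

/-- A finite product version of submultiplicativity of `limsup` in `ℝ≥0∞`. -/
lemma ENNReal.limsup_prod_le {ι κ : Type*} {l : Filter κ} (s : Finset ι) (u : ι → κ → ℝ≥0∞)
    (hu : ∀ j, limsup (u j) l ≠ ∞) :
    limsup (fun k => ∏ j ∈ s, u j k) l ≤ ∏ j ∈ s, limsup (u j) l := by
  classical
  induction s using Finset.induction with
  | empty => simpa using limsup_le_of_le (h := by simp)
  | insert a s ha ih =>
    simp only [Finset.prod_insert ha]
    have h1 : ∏ j ∈ s, limsup (u j) l ≠ ∞ := ENNReal.prod_ne_top fun j _ => hu j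
    exact (ENNReal.limsup_mul_le' (Or.inr (ne_top_of_le_ne_top h1 ih)) (Or.inl (hu a))).trans
      (mul_le_mul_right ih _)

lemma ENNReal.limsup_rpow {κ : Type*} {l : Filter κ} (u : κ → ℝ≥0∞) {r : ℝ} (hr : 0 < r) :
    limsup (fun k => u k ^ r) l = limsup u l ^ r :=
  ((ENNReal.orderIsoRpow r hr).limsup_apply (u := u) (f := l)).symm

/-- The maximal absolute row sum of a real matrix, as an extended nonnegative real. -/
noncomputable def rowSumNorm {n : ℕ} (A : Matrix (Fin n) (Fin n) ℝ) : ℝ≥0∞ :=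
  ‖A.map (fun x => (x : ℂ))‖ₑ

lemma rowSumNorm_eq {n : ℕ} (A : Matrix (Fin n) (Fin n) ℝ) :
    rowSumNorm A = univ.sup fun x => ∑ y, ‖A x y‖ₑ := by
  rw [rowSumNorm, enorm_eq_nnnorm, Matrix.linfty_opNNNorm_def,
    Finset.apply_sup_eq_sup_comp (fun a : ℝ≥0 => (a : ℝ≥0∞)) (fun _ _ => ENNReal.coe_max _ _) rfl]
  congr 1
  ext x
  simp [enorm_eq_nnnorm]

lemma rowSumNorm_ne_top {n : ℕ} (A : Matrix (Fin n) (Fin n) ℝ) : rowSumNorm A ≠ ∞ := enorm_ne_top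

lemma specRad_le_rowSumNorm {n : ℕ} (hn : 0 < n) (A : Matrix (Fin n) (Fin n) ℝ) :
    specRad A ≤ rowSumNorm A := by
  have : Nonempty (Fin n) := ⟨⟨0, hn⟩⟩
  have : NormOneClass (Matrix (Fin n) (Fin n) ℂ) := Matrix.linfty_opNormOneClass
  exact spectrum.spectralRadius_le_nnnorm _

lemma tendsto_rowSumNorm_pow {n : ℕ} (A : Matrix (Fin n) (Fin n) ℝ) :
    Tendsto (fun k : ℕ => rowSumNorm (A ^ k) ^ (1 / (k : ℝ))) atTop (𝓝 (specRad A)) := by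
  have h := spectrum.pow_nnnorm_pow_one_div_tendsto_nhds_spectralRadius
    (A.map (fun x => (x : ℂ)))
  refine h.congr fun k => ?_
  have : (A ^ k).map (fun x => (x : ℂ)) = (A.map (fun x => (x : ℂ))) ^ k :=
    Matrix.map_pow A Complex.ofRealHom k
  rw [rowSumNorm, this, enorm_eq_nnnorm]

lemma rowSumNorm_mul_le {n : ℕ} (A B : Matrix (Fin n) (Fin n) ℝ) :
    rowSumNorm (A * B) ≤ rowSumNorm A * rowSumNorm B := by
  have : (A * B).map (fun x => (x : ℂ)) = A.map (fun x => (x : ℂ)) * B.map (fun x => (x : ℂ)) :=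
    Matrix.map_mul (f := Complex.ofRealHom)
  simp only [rowSumNorm, this, enorm_eq_nnnorm]
  exact_mod_cast nnnorm_mul_le _ _

lemma rowSumNorm_one_le {n : ℕ} : rowSumNorm (1 : Matrix (Fin n) (Fin n) ℝ) ≤ 1 := by
  rw [rowSumNorm_eq]
  refine Finset.sup_le fun x _ => ?_
  rw [Finset.sum_eq_single x] <;> simp +contextual [eq_comm]

lemma matListProd_succ {n k : ℕ} (A : Fin (k + 1) → Matrix (Fin n) (Fin n) ℝ) :
    matListProd A = A 0 * matListProd fun i : Fin k => A i.succ := by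
  simp [matListProd, List.ofFn_succ]

lemma rowSumNorm_matListProd_le {n : ℕ} {K : ℝ≥0∞} {k : ℕ}
    (A : Fin k → Matrix (Fin n) (Fin n) ℝ) (hA : ∀ i, rowSumNorm (A i) ≤ K) :
    rowSumNorm (matListProd A) ≤ K ^ k := by
  induction k with
  | zero => simpa [matListProd] using rowSumNorm_one_le
  | succ k ih =>
    rw [matListProd_succ, pow_succ']
    exact (rowSumNorm_mul_le _ _).trans (mul_le_mul' (hA 0) (ih _ fun i => hA _))

lemma abs_apply_le_opNorm {n : ℕ} (A : Matrix (Fin n) (Fin n) ℝ) (x y : Fin n) :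
    |A x y| ≤ opNorm A := by
  have h := (LinearMap.toContinuousLinearMap (Matrix.toEuclideanLin A)).le_opNorm
    (EuclideanSpace.single y (1 : ℝ))
  have h2 := (PiLp.norm_apply_le (LinearMap.toContinuousLinearMap (Matrix.toEuclideanLin A)
    (EuclideanSpace.single y (1 : ℝ))) x).trans h
  simpa [Matrix.toEuclideanLin, Matrix.toLpLin_apply, opNorm] using h2

lemma rowSumNorm_le_of_opNorm_le {n : ℕ} {A : Matrix (Fin n) (Fin n) ℝ} {C : ℝ}
    (hA : opNorm A ≤ C) : rowSumNorm A ≤ n * ENNReal.ofReal C := by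
  rw [rowSumNorm_eq]
  refine Finset.sup_le fun x _ => ?_
  calc ∑ y, ‖A x y‖ₑ ≤ ∑ _y : Fin n, ENNReal.ofReal C := by
        gcongr with y
        rw [← ofReal_norm]
        exact ENNReal.ofReal_le_ofReal ((abs_apply_le_opNorm A x y).trans hA)
    _ = _ := by simp

lemma genSpecRad_ne_top {n : ℕ} (hn : 0 < n) {S : Set (Matrix (Fin n) (Fin n) ℝ)}
    (hS : ∃ C : ℝ, ∀ B ∈ S, opNorm B ≤ C) : genSpecRad S ≠ ∞ := by
  obtain ⟨C, hC⟩ := hS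
  set K : ℝ≥0∞ := n * ENNReal.ofReal C with hK
  have hKt : K ≠ ∞ := ENNReal.mul_ne_top (by simp) (by simp)
  refine ne_top_of_le_ne_top hKt ?_
  refine limsup_le_of_le (h := ?_)
  filter_upwards [eventually_gt_atTop 0] with k hk
  have hsup : (⨆ B ∈ setPow S k, specRad B) ≤ K ^ k := by
    refine iSup₂_le ?_
    rintro _ ⟨A, hA, rfl⟩
    exact (specRad_le_rowSumNorm hn _).trans
      (rowSumNorm_matListProd_le A fun i => rowSumNorm_le_of_opNorm_le (hC _ (hA i)))
  calc _ ≤ (K ^ k) ^ (1 / (k : ℝ)) := ENNReal.rpow_le_rpow hsup (by positivity)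
    _ = K := by rw [one_div, ENNReal.pow_rpow_inv_natCast hk.ne']

/-- `B` is dominated entrywise by the weighted geometric mean of the matrices `C j`. -/
def HadDominated {n m : ℕ} (α : Fin m → ℝ) (B : Matrix (Fin n) (Fin n) ℝ)
    (C : Fin m → Matrix (Fin n) (Fin n) ℝ) : Prop :=
  ∀ x y, ‖B x y‖ₑ ≤ ∏ j, ‖C j x y‖ₑ ^ α j

section

variable {n m : ℕ} {α : Fin m → ℝ}

lemma hadDominated_hadWMean (hα : ∀ j, 0 ≤ α j) {C : Fin m → Matrix (Fin n) (Fin n) ℝ}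
    (hC : ∀ j x y, 0 ≤ C j x y) : HadDominated α (hadWMean α C) C := by
  intro x y
  refine le_of_eq ?_
  simp only [hadWMean, Matrix.of_apply]
  rw [Real.enorm_of_nonneg (prod_nonneg fun j _ => Real.rpow_nonneg (hC j x y) _),
    ENNReal.ofReal_prod_of_nonneg fun j _ => Real.rpow_nonneg (hC j x y) _]
  refine prod_congr rfl fun j _ => ?_
  rw [Real.enorm_of_nonneg (hC j x y), ENNReal.ofReal_rpow_of_nonneg (hC j x y) (hα j)]

lemma HadDominated.one :
    HadDominated α (1 : Matrix (Fin n) (Fin n) ℝ) fun _ => 1 := by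
  intro x y
  by_cases h : x = y
  · subst h
    simp
  · simp [Matrix.one_apply_ne h]

lemma enorm_mul_apply_of_nonneg {A B : Matrix (Fin n) (Fin n) ℝ} (hA : ∀ x y, 0 ≤ A x y)
    (hB : ∀ x y, 0 ≤ B x y) (x y : Fin n) :
    ‖(A * B) x y‖ₑ = ∑ z, ‖A x z‖ₑ * ‖B z y‖ₑ := by
  have h : ∀ z, 0 ≤ A x z * B z y := fun z => mul_nonneg (hA _ _) (hB _ _)
  rw [Matrix.mul_apply, Real.enorm_of_nonneg (sum_nonneg fun z _ => h z),
    ENNReal.ofReal_sum_of_nonneg fun z _ => h z]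
  refine sum_congr rfl fun z _ => ?_
  rw [← Real.enorm_of_nonneg (h z), enorm_mul]

lemma HadDominated.mul (hα : ∀ j, 0 ≤ α j) (hαsum : ∑ j, α j = 1)
    {B B' : Matrix (Fin n) (Fin n) ℝ} {C C' : Fin m → Matrix (Fin n) (Fin n) ℝ}
    (hC : ∀ j x y, 0 ≤ C j x y) (hC' : ∀ j x y, 0 ≤ C' j x y)
    (h : HadDominated α B C) (h' : HadDominated α B' C') :
    HadDominated α (B * B') fun j => C j * C' j := by
  intro x y
  calc ‖(B * B') x y‖ₑ ≤ ∑ z, ‖B x z * B' z y‖ₑ := by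
        rw [Matrix.mul_apply]; exact enorm_sum_le _ _
    _ ≤ ∑ z, ∏ j, (‖C j x z‖ₑ * ‖C' j z y‖ₑ) ^ α j := by
        gcongr with z
        simp only [ENNReal.mul_rpow_of_nonneg _ _ (hα _), prod_mul_distrib, enorm_mul]
        exact mul_le_mul' (h x z) (h' z y)
    _ ≤ ∏ j, (∑ z, ‖C j x z‖ₑ * ‖C' j z y‖ₑ) ^ α j := ENNReal.sum_prod_rpow_le _ hα hαsum
    _ = _ := by simp only [enorm_mul_apply_of_nonneg (hC _) (hC' _)]

lemma mul_apply_nonneg {A B : Matrix (Fin n) (Fin n) ℝ} (hA : ∀ x y, 0 ≤ A x y)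
    (hB : ∀ x y, 0 ≤ B x y) (x y : Fin n) : 0 ≤ (A * B) x y := by
  rw [Matrix.mul_apply]
  exact sum_nonneg fun z _ => mul_nonneg (hA _ _) (hB _ _)

lemma one_apply_nonneg (x y : Fin n) : 0 ≤ (1 : Matrix (Fin n) (Fin n) ℝ) x y := by
  rw [Matrix.one_apply]; split_ifs <;> simp

lemma pow_apply_nonneg {A : Matrix (Fin n) (Fin n) ℝ} (hA : ∀ x y, 0 ≤ A x y) (k : ℕ) :
    ∀ x y, 0 ≤ (A ^ k) x y := by
  induction k with
  | zero => simpa using one_apply_nonneg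
  | succ k ih => rw [pow_succ]; exact mul_apply_nonneg ih hA

lemma matListProd_apply_nonneg {k : ℕ} {A : Fin k → Matrix (Fin n) (Fin n) ℝ}
    (hA : ∀ i x y, 0 ≤ A i x y) : ∀ x y, 0 ≤ matListProd A x y := by
  induction k with
  | zero => simpa [matListProd] using one_apply_nonneg
  | succ k ih =>
    rw [matListProd_succ]
    exact mul_apply_nonneg (hA 0) (ih fun i => hA _)

lemma HadDominated.pow (hα : ∀ j, 0 ≤ α j) (hαsum : ∑ j, α j = 1)
    {B : Matrix (Fin n) (Fin n) ℝ} {C : Fin m → Matrix (Fin n) (Fin n) ℝ}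
    (hC : ∀ j x y, 0 ≤ C j x y) (h : HadDominated α B C) (k : ℕ) :
    HadDominated α (B ^ k) fun j => C j ^ k := by
  induction k with
  | zero => simpa using HadDominated.one (α := α) (n := n)
  | succ k ih =>
    simp only [pow_succ]
    exact ih.mul hα hαsum (fun j => pow_apply_nonneg (hC j) k) hC h

lemma HadDominated.matListProd (hα : ∀ j, 0 ≤ α j) (hαsum : ∑ j, α j = 1) {k : ℕ}
    {B : Fin k → Matrix (Fin n) (Fin n) ℝ} {C : Fin k → Fin m → Matrix (Fin n) (Fin n) ℝ}
    (hC : ∀ i j x y, 0 ≤ C i j x y) (h : ∀ i, HadDominated α (B i) (C i)) :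
    HadDominated α (matListProd B) fun j => _root_.matListProd fun i => C i j := by
  induction k with
  | zero => simpa [_root_.matListProd] using HadDominated.one (α := α) (n := n)
  | succ k ih =>
    simp only [matListProd_succ]
    exact (h 0).mul hα hαsum (hC 0) (fun j => matListProd_apply_nonneg fun i => hC _ j)
      (ih (fun i => hC _) fun i => h _)

lemma HadDominated.rowSumNorm_le (hα : ∀ j, 0 ≤ α j) (hαsum : ∑ j, α j = 1)
    {B : Matrix (Fin n) (Fin n) ℝ} {C : Fin m → Matrix (Fin n) (Fin n) ℝ}
    (h : HadDominated α B C) : rowSumNorm B ≤ ∏ j, rowSumNorm (C j) ^ α j := by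
  rw [rowSumNorm_eq]
  refine Finset.sup_le fun x _ => ?_
  calc ∑ y, ‖B x y‖ₑ ≤ ∑ y, ∏ j, ‖C j x y‖ₑ ^ α j := sum_le_sum fun y _ => h x y
    _ ≤ ∏ j, (∑ y, ‖C j x y‖ₑ) ^ α j := ENNReal.sum_prod_rpow_le _ hα hαsum
    _ ≤ _ := prod_le_prod' fun j _ => ENNReal.rpow_le_rpow (by
        rw [rowSumNorm_eq]
        exact Finset.le_sup (f := fun x => ∑ y, ‖C j x y‖ₑ) (mem_univ x)) (hα j)

lemma HadDominated.specRad_le (hn : 0 < n) (hα : ∀ j, 0 < α j) (hαsum : ∑ j, α j = 1)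
    {B : Matrix (Fin n) (Fin n) ℝ} {C : Fin m → Matrix (Fin n) (Fin n) ℝ}
    (hC : ∀ j x y, 0 ≤ C j x y) (h : HadDominated α B C) :
    specRad B ≤ ∏ j, specRad (C j) ^ α j := by
  have hα' := fun j => (hα j).le
  have hlim := fun j => (tendsto_rowSumNorm_pow (C j)).limsup_eq
  rw [← (tendsto_rowSumNorm_pow B).limsup_eq]
  simp only [← hlim, ← ENNReal.limsup_rpow _ (hα _)]
  refine le_trans (limsup_le_limsup (Eventually.of_forall fun k => ?_))
    (ENNReal.limsup_prod_le univ _ fun j => ?_)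
  · refine (ENNReal.rpow_le_rpow ((h.pow hα' hαsum hC k).rowSumNorm_le hα' hαsum)
      (by positivity)).trans_eq ?_
    rw [← ENNReal.prod_rpow_of_nonneg (by positivity)]
    exact prod_congr rfl fun j _ => by rw [← ENNReal.rpow_mul, ← ENNReal.rpow_mul, mul_comm]
  · rw [ENNReal.limsup_rpow _ (hα j), hlim]
    exact ENNReal.rpow_ne_top_of_nonneg (hα' j)
      (ne_top_of_le_ne_top (rowSumNorm_ne_top _) (specRad_le_rowSumNorm hn _))

end

end WeightedHadamardMeans

/-- Theorem 3.3, inequality (10), for bounded sets of non-negative matrices: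
`ρ(Ψ₁^(α₁) ∘ ⋯ ∘ Ψₘ^(αₘ)) ≤ ρ(Ψ₁)^(α₁) ⋯ ρ(Ψₘ)^(αₘ)` for the generalized
spectral radius. -/
theorem genSpecRad_setHadWMean_le {m n : ℕ} (hm : 0 < m) (hn : 0 < n)
    (Ψ : Fin m → Set (Matrix (Fin n) (Fin n) ℝ))
    (hne : ∀ j, (Ψ j).Nonempty)
    (hbdd : ∀ j, ∃ C : ℝ, ∀ B ∈ Ψ j, opNorm B ≤ C)
    (hpos : ∀ j, ∀ B ∈ Ψ j, ∀ x y, 0 ≤ B x y)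
    (α : Fin m → ℝ) (hα : ∀ j, 0 < α j) (hαsum : ∑ j, α j = 1) :
    genSpecRad (setHadWMean α Ψ) ≤ ∏ j, genSpecRad (Ψ j) ^ (α j) := by
  have hα' := fun j => (hα j).le
  simp only [genSpecRad, ← ENNReal.limsup_rpow _ (hα _)]
  refine le_trans (Filter.limsup_le_limsup (Filter.Eventually.of_forall fun k => ?_))
    (ENNReal.limsup_prod_le Finset.univ _ fun j => ?_)
  · have hsup : (⨆ B ∈ setPow (setHadWMean α Ψ) k, specRad B) ≤
        ∏ j, (⨆ B ∈ setPow (Ψ j) k, specRad B) ^ α j := by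
      refine iSup₂_le ?_
      rintro _ ⟨A, hA, rfl⟩
      choose C hC hAC using hA
      have hC0 : ∀ i j x y, 0 ≤ C i j x y := fun i j => hpos j _ (hC i j)
      have hdom : HadDominated α (matListProd A) fun j => matListProd fun i => C i j :=
        HadDominated.matListProd hα' hαsum hC0 fun i => by
          rw [hAC i]; exact hadDominated_hadWMean hα' (hC0 i)
      refine (hdom.specRad_le hn hα hαsum fun j =>
        matListProd_apply_nonneg fun i => hC0 i j).trans ?_
      exact Finset.prod_le_prod' fun j _ => ENNReal.rpow_le_rpow
        (le_iSup₂_of_le _ ⟨fun i => C i j, fun i => hC i j, rfl⟩ le_rfl) (hα' j)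
    refine (ENNReal.rpow_le_rpow hsup (by positivity)).trans_eq ?_
    rw [← ENNReal.prod_rpow_of_nonneg (by positivity)]
    exact Finset.prod_congr rfl fun j _ => by
      rw [← ENNReal.rpow_mul, ← ENNReal.rpow_mul, mul_comm]
  · rw [ENNReal.limsup_rpow _ (hα j)]
    exact ENNReal.rpow_ne_top_of_nonneg (hα' j) (genSpecRad_ne_top hn (hbdd j))
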